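/- Let R : ℝ → M₂(ℂ) be a smooth curve with R(s) ∈ SU₂ for all s (i.e. R(s)*·R(s) = I and det R(s) = 1), and suppose dR/ds(s) = R(s)·(u₁(s)A₁ + u₂(s)A₂ + u₃(s)A₃) for smooth real functions u₁, u₂, u₃. Let Λ(s) = R(s)·B₁·R(s)*. Then 2·tr((dΛ/ds(s))²) = u₂(s)² + u₃(s)² for all s. -/

import Mathlib

open Matrix

noncomputable section

attribute [local instance] Matrix.normedAddCommGroup Matrix.normedSpace

/-- The Pauli matrix `A₁`. -/
def A1 : Matrix (Fin 2) (Fin 2) ℂ := (1 / 2 : ℂ) • !![Complex.I, 0; 0, -Complex.I]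

/-- The Pauli matrix `A₂`. -/
def A2 : Matrix (Fin 2) (Fin 2) ℂ := (1 / 2 : ℂ) • !![0, 1; -1, 0]

/-- The Pauli matrix `A₃`. -/
def A3 : Matrix (Fin 2) (Fin 2) ℂ := (1 / 2 : ℂ) • !![0, Complex.I; Complex.I, 0]

/-- The Hermitian Pauli matrix `B₁`. -/
def B1 : Matrix (Fin 2) (Fin 2) ℂ := (1 / 2 : ℂ) • !![1, 0; 0, -1]

theorem hasDerivAt_matrix_iff {m n : Type*} [Fintype m] [Fintype n] {M : ℝ → Matrix m n ℂ}
    {M' : Matrix m n ℂ} {s : ℝ} :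
    HasDerivAt M M' s ↔ ∀ i j, HasDerivAt (fun t => M t i j) (M' i j) s :=
  (hasDerivAt_pi (φ := M) (φ' := M')).trans (forall_congr' fun _ => hasDerivAt_pi)

theorem HasDerivAt.matrix_mul {l m n : Type*} [Fintype l] [Fintype m] [Fintype n]
    {M : ℝ → Matrix l m ℂ} {N : ℝ → Matrix m n ℂ} {M' : Matrix l m ℂ} {N' : Matrix m n ℂ} {s : ℝ}
    (hM : HasDerivAt M M' s) (hN : HasDerivAt N N' s) :
    HasDerivAt (fun t => M t * N t) (M' * N s + M s * N') s := by
  rw [hasDerivAt_matrix_iff] at *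
  intro i j
  simp only [Matrix.mul_apply, Matrix.add_apply, ← Finset.sum_add_distrib]
  exact HasDerivAt.fun_sum fun k _ => (hM i k).mul (hN k j)

theorem HasDerivAt.matrix_conjTranspose {m n : Type*} [Fintype m] [Fintype n]
    {M : ℝ → Matrix m n ℂ} {M' : Matrix m n ℂ} {s : ℝ} (hM : HasDerivAt M M' s) :
    HasDerivAt (fun t => (M t)ᴴ) M'ᴴ s := by
  rw [hasDerivAt_matrix_iff] at *
  exact fun i j => (hM j i).star

theorem trace_sq_conj_of_unitary {n : Type*} [Fintype n] [DecidableEq n] {R : Matrix n n ℂ}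
    (hR : Rᴴ * R = 1) (C : Matrix n n ℂ) :
    ((R * C * Rᴴ) * (R * C * Rᴴ)).trace = (C * C).trace := by
  have h : (R * C * Rᴴ) * (R * C * Rᴴ) = R * (C * (Rᴴ * R) * C) * Rᴴ := by
    simp only [Matrix.mul_assoc]
  rw [h, hR, Matrix.mul_one, Matrix.trace_mul_comm, ← Matrix.mul_assoc, hR, Matrix.one_mul]

theorem trace_sq_pauli (a b c : ℝ) :
    let U := (a : ℂ) • A1 + (b : ℂ) • A2 + (c : ℂ) • A3
    2 * ((U * B1 + B1 * Uᴴ) * (U * B1 + B1 * Uᴴ)).trace = ((b ^ 2 + c ^ 2 : ℝ) : ℂ) := by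
  simp only [A1, A2, A3, B1, Matrix.trace_fin_two, Matrix.mul_apply, Matrix.add_apply,
    Fin.sum_univ_two, Matrix.conjTranspose_apply, Matrix.smul_apply]
  simp
  ring_nf
  simp only [Complex.I_sq]
  ring

theorem stmt_10 (R : ℝ → Matrix (Fin 2) (Fin 2) ℂ) (u₁ u₂ u₃ : ℝ → ℝ)
    (hR : ContDiff ℝ (⊤ : ℕ∞) R)
    (hu₁ : ContDiff ℝ (⊤ : ℕ∞) u₁) (hu₂ : ContDiff ℝ (⊤ : ℕ∞) u₂) (hu₃ : ContDiff ℝ (⊤ : ℕ∞) u₃)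
    (hSU : ∀ s, (R s)ᴴ * R s = 1 ∧ (R s).det = 1)
    (hode : ∀ s, deriv R s
      = R s * ((u₁ s : ℂ) • A1 + (u₂ s : ℂ) • A2 + (u₃ s : ℂ) • A3))
    (Λ : ℝ → Matrix (Fin 2) (Fin 2) ℂ)
    (hΛ : ∀ s, Λ s = R s * B1 * (R s)ᴴ) :
    ∀ s, 2 * ((deriv Λ s * deriv Λ s).trace)
      = ((u₂ s ^ 2 + u₃ s ^ 2 : ℝ) : ℂ) := by
  intro s
  have hR' : HasDerivAt R (deriv R s) s := (hR.differentiable (by simp) s).hasDerivAt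
  rw [hode s] at hR'
  set U := (u₁ s : ℂ) • A1 + (u₂ s : ℂ) • A2 + (u₃ s : ℂ) • A3
  have hΛ' : deriv Λ s = R s * (U * B1 + B1 * Uᴴ) * (R s)ᴴ := by
    rw [funext hΛ]
    refine ((hR'.matrix_mul (hasDerivAt_const s B1)).matrix_mul
      hR'.matrix_conjTranspose).deriv.trans ?_
    simp only [Matrix.conjTranspose_mul, Matrix.mul_zero, add_zero, Matrix.mul_add,
      Matrix.add_mul, Matrix.mul_assoc]
  rw [hΛ', trace_sq_conj_of_unitary (hSU s).1]
  exact trace_sq_pauli (u₁ s) (u₂ s) (u₃ s)
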